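/- arXiv:1612.02234 — 2 statements merged into one kernel-verified Lean document; each statement's English description precedes it below -/
import Mathlib

section
/- Up to graph isomorphism, among the connected simple graphs on 6 vertices with a unique perfect matching there is exactly one whose adjacency matrix has determinant different from ±1 (its determinant equals ±3); all the other 19 isomorphism classes have adjacency determinant equal to 1 or −1, hence are integrally invertible. -/
open Matrix

/-- A simple graph has a unique perfect matching (unique 1-factor) if there is
exactly one perfect matching. -/
def HasUniquePM {V : Type*} (G : SimpleGraph V) : Prop :=
  ∃! M : G.Subgraph, M.IsPerfectMatching

/-- The integer adjacency matrix of a finite simple graph. -/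
noncomputable def adjMat {V : Type*} [Fintype V] [DecidableEq V]
    (G : SimpleGraph V) : Matrix V V ℤ :=
  letI := Classical.decRel G.Adj
  G.adjMatrix ℤ



/-- The renumbered adjacency table, with matching 01, 23, 45. -/
def tab (x02 x03 x04 x05 x12 x13 x14 x15 x24 x25 x34 x35 : Bool) : Fin 6 → Fin 6 → Bool :=
  ![![false, true, x02, x03, x04, x05],
    ![true, false, x12, x13, x14, x15],
    ![x02, x12, false, true, x24, x25],
    ![x03, x13, true, false, x34, x35],
    ![x04, x14, x24, x34, false, true],
    ![x05, x15, x25, x35, true, false]]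

/-- The fixed point free involutions other than the standard one. -/
def others : List (Fin 6 → Fin 6) :=
  [![1, 0, 4, 5, 2, 3],
   ![1, 0, 5, 4, 3, 2],
   ![2, 3, 0, 1, 5, 4],
   ![2, 4, 0, 5, 1, 3],
   ![2, 5, 0, 4, 3, 1],
   ![3, 2, 1, 0, 5, 4],
   ![3, 4, 5, 0, 1, 2],
   ![3, 5, 4, 0, 2, 1],
   ![4, 2, 1, 5, 0, 3],
   ![4, 3, 5, 1, 0, 2],
   ![4, 5, 3, 2, 0, 1],
   ![5, 2, 1, 4, 3, 0],
   ![5, 3, 4, 1, 2, 0],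
   ![5, 4, 3, 2, 1, 0]]

/-- Renumberings of the exceptional graph. -/
def permList : List (Fin 6 → Fin 6) :=
  [![0, 1, 2, 3, 4, 5],
   ![0, 1, 3, 2, 4, 5],
   ![0, 1, 4, 5, 2, 3],
   ![0, 1, 4, 5, 3, 2],
   ![2, 3, 0, 1, 4, 5],
   ![2, 3, 4, 5, 0, 1]]

/-- Adjacency table of the exceptional graph. -/
def tab0 : Fin 6 → Fin 6 → Bool := ![![false, true, true, false, false, false], ![true, false, true, false, false, false], ![true, true, false, true, false, false], ![false, false, true, false, true, true], ![false, false, false, true, false, true], ![false, false, false, true, true, false]]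

/-- Integer matrix of a Boolean table. -/
def tabZ (b : Fin 6 → Fin 6 → Bool) : Fin 6 → Fin 6 → ℤ := fun i j => if b i j then 1 else 0

/-- Test for the presence of a matching. -/
def hasM (b : Fin 6 → Fin 6 → Bool) (g : Fin 6 → Fin 6) : Bool :=
  b 0 (g 0) && b 1 (g 1) && b 2 (g 2) && b 3 (g 3) && b 4 (g 4) && b 5 (g 5)

/-- Some nonstandard matching is present. -/
def bad (x02 x03 x04 x05 x12 x13 x14 x15 x24 x25 x34 x35 : Bool) : Bool :=
  (x24 && x35) ||
  (x25 && x34) ||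
  (x02 && x13) ||
  (x02 && x14 && x35) ||
  (x02 && x15 && x34) ||
  (x03 && x12) ||
  (x03 && x14 && x25) ||
  (x03 && x15 && x24) ||
  (x04 && x12 && x35) ||
  (x04 && x13 && x25) ||
  (x04 && x15) ||
  (x05 && x12 && x34) ||
  (x05 && x13 && x24) ||
  (x05 && x14)

/-- Two disjoint triangles are present. -/
def tri (x02 x03 x04 x05 x12 x13 x14 x15 x24 x25 x34 x35 : Bool) : Bool :=
  (x02 && x12 && x34 && x35) ||
  (x03 && x13 && x24 && x25) ||
  (x04 && x14 && x25 && x35) ||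
  (x05 && x15 && x24 && x34) ||
  (x02 && x03 && x14 && x15) ||
  (x02 && x04 && x24 && x13 && x15 && x35) ||
  (x02 && x05 && x25 && x13 && x14 && x34) ||
  (x03 && x04 && x34 && x12 && x15 && x25) ||
  (x03 && x05 && x35 && x12 && x14 && x24) ||
  (x04 && x05 && x12 && x13)

/-- The table is a renumbered exceptional table. -/
def isTwoTri (x02 x03 x04 x05 x12 x13 x14 x15 x24 x25 x34 x35 : Bool) : Bool :=
  (x02 && !x03 && !x04 && !x05 && x12 && !x13 && !x14 && !x15 && !x24 && !x25 && x34 && x35) ||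
  (!x02 && x03 && !x04 && !x05 && !x12 && x13 && !x14 && !x15 && x24 && x25 && !x34 && !x35) ||
  (!x02 && !x03 && x04 && !x05 && !x12 && !x13 && x14 && !x15 && !x24 && x25 && !x34 && x35) ||
  (!x02 && !x03 && !x04 && x05 && !x12 && !x13 && !x14 && x15 && x24 && !x25 && x34 && !x35) ||
  (x02 && x03 && !x04 && !x05 && !x12 && !x13 && x14 && x15 && !x24 && !x25 && !x34 && !x35) ||
  (!x02 && !x03 && x04 && x05 && x12 && x13 && !x14 && !x15 && !x24 && !x25 && !x34 && !x35)

lemma isTwoTri_spec (x02 x03 x04 x05 x12 x13 x14 x15 x24 x25 x34 x35 : Bool)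
    (h : isTwoTri x02 x03 x04 x05 x12 x13 x14 x15 x24 x25 x34 x35 = true) :
    ∃ p ∈ permList, ∀ i j, tab x02 x03 x04 x05 x12 x13 x14 x15 x24 x25 x34 x35 i j = tab0 (p i) (p j) := by
  simp only [isTwoTri, Bool.or_eq_true, Bool.and_eq_true, Bool.not_eq_true', or_assoc,
    and_assoc] at h
  rcases h with h | h | h | h | h | h
  · obtain ⟨rfl, rfl, rfl, rfl, rfl, rfl, rfl, rfl, rfl, rfl, rfl, rfl⟩ := h
    exact ⟨![0, 1, 2, 3, 4, 5], by simp [permList], by decide⟩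
  · obtain ⟨rfl, rfl, rfl, rfl, rfl, rfl, rfl, rfl, rfl, rfl, rfl, rfl⟩ := h
    exact ⟨![0, 1, 3, 2, 4, 5], by simp [permList], by decide⟩
  · obtain ⟨rfl, rfl, rfl, rfl, rfl, rfl, rfl, rfl, rfl, rfl, rfl, rfl⟩ := h
    exact ⟨![0, 1, 4, 5, 2, 3], by simp [permList], by decide⟩
  · obtain ⟨rfl, rfl, rfl, rfl, rfl, rfl, rfl, rfl, rfl, rfl, rfl, rfl⟩ := h
    exact ⟨![0, 1, 4, 5, 3, 2], by simp [permList], by decide⟩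
  · obtain ⟨rfl, rfl, rfl, rfl, rfl, rfl, rfl, rfl, rfl, rfl, rfl, rfl⟩ := h
    exact ⟨![2, 3, 0, 1, 4, 5], by simp [permList], by decide⟩
  · obtain ⟨rfl, rfl, rfl, rfl, rfl, rfl, rfl, rfl, rfl, rfl, rfl, rfl⟩ := h
    exact ⟨![2, 3, 4, 5, 0, 1], by simp [permList], by decide⟩

lemma all_good : ∀ x02 x03 x04 x05 x12 x13 x14 x15 x24 x25 x34 x35 : Bool,
    (bad x02 x03 x04 x05 x12 x13 x14 x15 x24 x25 x34 x35 || !(tri x02 x03 x04 x05 x12 x13 x14 x15 x24 x25 x34 x35) ||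
      isTwoTri x02 x03 x04 x05 x12 x13 x14 x15 x24 x25 x34 x35) = true := by
  decide +kernel

lemma bad_spec (x02 x03 x04 x05 x12 x13 x14 x15 x24 x25 x34 x35 : Bool)
    (h : bad x02 x03 x04 x05 x12 x13 x14 x15 x24 x25 x34 x35 = true) :
    ∃ g ∈ others, hasM (tab x02 x03 x04 x05 x12 x13 x14 x15 x24 x25 x34 x35) g = true := by
  simp only [bad, Bool.or_eq_true, Bool.and_eq_true, or_assoc] at h
  rcases h with h | h | h | h | h | h | h | h | h | h | h | h | h | h
  · exact ⟨![1, 0, 4, 5, 2, 3], by simp [others], by simp [hasM, tab, h]⟩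
  · exact ⟨![1, 0, 5, 4, 3, 2], by simp [others], by simp [hasM, tab, h]⟩
  · exact ⟨![2, 3, 0, 1, 5, 4], by simp [others], by simp [hasM, tab, h]⟩
  · exact ⟨![2, 4, 0, 5, 1, 3], by simp [others], by simp [hasM, tab, h]⟩
  · exact ⟨![2, 5, 0, 4, 3, 1], by simp [others], by simp [hasM, tab, h]⟩
  · exact ⟨![3, 2, 1, 0, 5, 4], by simp [others], by simp [hasM, tab, h]⟩
  · exact ⟨![3, 4, 5, 0, 1, 2], by simp [others], by simp [hasM, tab, h]⟩
  · exact ⟨![3, 5, 4, 0, 2, 1], by simp [others], by simp [hasM, tab, h]⟩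
  · exact ⟨![4, 2, 1, 5, 0, 3], by simp [others], by simp [hasM, tab, h]⟩
  · exact ⟨![4, 3, 5, 1, 0, 2], by simp [others], by simp [hasM, tab, h]⟩
  · exact ⟨![4, 5, 3, 2, 0, 1], by simp [others], by simp [hasM, tab, h]⟩
  · exact ⟨![5, 2, 1, 4, 3, 0], by simp [others], by simp [hasM, tab, h]⟩
  · exact ⟨![5, 3, 4, 1, 2, 0], by simp [others], by simp [hasM, tab, h]⟩
  · exact ⟨![5, 4, 3, 2, 1, 0], by simp [others], by simp [hasM, tab, h]⟩

set_option maxHeartbeats 4000000 in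
lemma det6 (x02 x03 x04 x05 x12 x13 x14 x15 x24 x25 x34 x35 : ℤ)
    (h0 : x24 * x35 = 0)
    (h1 : x25 * x34 = 0)
    (h2 : x02 * x13 = 0)
    (h3 : x02 * x14 * x35 = 0)
    (h4 : x02 * x15 * x34 = 0)
    (h5 : x03 * x12 = 0)
    (h6 : x03 * x14 * x25 = 0)
    (h7 : x03 * x15 * x24 = 0)
    (h8 : x04 * x12 * x35 = 0)
    (h9 : x04 * x13 * x25 = 0)
    (h10 : x04 * x15 = 0)
    (h11 : x05 * x12 * x34 = 0)
    (h12 : x05 * x13 * x24 = 0)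
    (h13 : x05 * x14 = 0)
    (t0 : x02 * x12 * x34 * x35 = 0)
    (t1 : x03 * x13 * x24 * x25 = 0)
    (t2 : x04 * x14 * x25 * x35 = 0)
    (t3 : x05 * x15 * x24 * x34 = 0)
    (t4 : x02 * x03 * x14 * x15 = 0)
    (t5 : x02 * x04 * x24 * x13 * x15 * x35 = 0)
    (t6 : x02 * x05 * x25 * x13 * x14 * x34 = 0)
    (t7 : x03 * x04 * x34 * x12 * x15 * x25 = 0)
    (t8 : x03 * x05 * x35 * x12 * x14 * x24 = 0)
    (t9 : x04 * x05 * x12 * x13 = 0) :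
    (!![0, 1, x02, x03, x04, x05;
    1, 0, x12, x13, x14, x15;
    x02, x12, 0, 1, x24, x25;
    x03, x13, 1, 0, x34, x35;
    x04, x14, x24, x34, 0, 1;
    x05, x15, x25, x35, 1, 0] : Matrix (Fin 6) (Fin 6) ℤ).det = -1 := by
  simp [Matrix.det_succ_row_zero, Fin.sum_univ_succ, Fin.succAbove]
  linear_combination (2 - x24 * x35) * h0 +
    (2 + 2 * x24 * x35 - x25 * x34) * h1 +
    (2 - 2 * x24 * x35 - 2 * x25 * x34 - x02 * x13) * h2 +
    (-2 + 2 * x24 * x35 - 2 * x25 * x34 + 2 * x02 * x13 - x02 * x14 * x35) * h3 +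
    (-2 - 2 * x24 * x35 + 2 * x25 * x34 + 2 * x02 * x13 + 2 * x02 * x14 * x35 - x02 * x15 * x34) * h4 +
    (2 - 2 * x24 * x35 - 2 * x25 * x34 + 2 * x02 * x13 - 2 * x02 * x14 * x35 - 2 * x02 * x15 * x34 - x03 * x12) * h5 +
    (-2 - 2 * x24 * x35 + 2 * x25 * x34 - 2 * x02 * x13 + 2 * x02 * x14 * x35 - 2 * x02 * x15 * x34 + 2 * x03 * x12 - x03 * x14 * x25) * h6 +
    (-2 + 2 * x24 * x35 - 2 * x25 * x34 - 2 * x02 * x13 - 2 * x02 * x14 * x35 + 2 * x02 * x15 * x34 + 2 * x03 * x12 + 2 * x03 * x14 * x25 - x03 * x15 * x24) * h7 +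
    (-2 + 2 * x24 * x35 - 2 * x25 * x34 - 2 * x02 * x13 + 2 * x02 * x14 * x35 - 2 * x02 * x15 * x34 + 2 * x03 * x12 - 2 * x03 * x14 * x25 - 2 * x03 * x15 * x24 - x04 * x12 * x35) * h8 +
    (-2 - 2 * x24 * x35 + 2 * x25 * x34 + 2 * x02 * x13 - 2 * x02 * x14 * x35 - 2 * x02 * x15 * x34 - 2 * x03 * x12 + 2 * x03 * x14 * x25 - 2 * x03 * x15 * x24 + 2 * x04 * x12 * x35 - x04 * x13 * x25) * h9 +
    (2 - 2 * x24 * x35 - 2 * x25 * x34 - 2 * x02 * x13 - 2 * x02 * x14 * x35 + 2 * x02 * x15 * x34 - 2 * x03 * x12 - 2 * x03 * x14 * x25 + 2 * x03 * x15 * x24 + 2 * x04 * x12 * x35 + 2 * x04 * x13 * x25 - x04 * x15) * h10 +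
    (-2 - 2 * x24 * x35 + 2 * x25 * x34 - 2 * x02 * x13 - 2 * x02 * x14 * x35 + 2 * x02 * x15 * x34 + 2 * x03 * x12 - 2 * x03 * x14 * x25 - 2 * x03 * x15 * x24 + 2 * x04 * x12 * x35 - 2 * x04 * x13 * x25 - 2 * x04 * x15 - x05 * x12 * x34) * h11 +
    (-2 + 2 * x24 * x35 - 2 * x25 * x34 + 2 * x02 * x13 - 2 * x02 * x14 * x35 - 2 * x02 * x15 * x34 - 2 * x03 * x12 - 2 * x03 * x14 * x25 + 2 * x03 * x15 * x24 - 2 * x04 * x12 * x35 + 2 * x04 * x13 * x25 - 2 * x04 * x15 + 2 * x05 * x12 * x34 - x05 * x13 * x24) * h12 +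
    (2 - 2 * x24 * x35 - 2 * x25 * x34 - 2 * x02 * x13 + 2 * x02 * x14 * x35 - 2 * x02 * x15 * x34 - 2 * x03 * x12 + 2 * x03 * x14 * x25 - 2 * x03 * x15 * x24 - 2 * x04 * x12 * x35 - 2 * x04 * x13 * x25 + 2 * x04 * x15 + 2 * x05 * x12 * x34 + 2 * x05 * x13 * x24 - x05 * x14) * h13 +
    4 * t0 +
    4 * t1 +
    4 * t2 +
    4 * t3 +
    4 * t4 +
    4 * t5 +
    4 * t6 +
    4 * t7 +
    4 * t8 +
    4 * t9

/-- Boolean to integer. -/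
def bz (b : Bool) : ℤ := if b then 1 else 0

lemma bz_and (a b : Bool) : bz (a && b) = bz a * bz b := by cases a <;> cases b <;> rfl

lemma bz_false {b : Bool} (h : b = false) : bz b = 0 := by rw [h]; rfl

lemma det_tab (x02 x03 x04 x05 x12 x13 x14 x15 x24 x25 x34 x35 : Bool)
    (h : bad x02 x03 x04 x05 x12 x13 x14 x15 x24 x25 x34 x35 = false)
    (ht : tri x02 x03 x04 x05 x12 x13 x14 x15 x24 x25 x34 x35 = false) :
    Matrix.det (n := Fin 6) (tabZ (tab x02 x03 x04 x05 x12 x13 x14 x15 x24 x25 x34 x35)) = -1 := by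
  simp only [bad, Bool.or_eq_false_iff, and_assoc] at h
  simp only [tri, Bool.or_eq_false_iff, and_assoc] at ht
  obtain ⟨h0, h1, h2, h3, h4, h5, h6, h7, h8, h9, h10, h11, h12, h13⟩ := h
  obtain ⟨t0, t1, t2, t3, t4, t5, t6, t7, t8, t9⟩ := ht
  have e := det6 (bz x02) (bz x03) (bz x04) (bz x05) (bz x12) (bz x13) (bz x14) (bz x15) (bz x24) (bz x25) (bz x34) (bz x35)
    (by simpa only [bz_and] using bz_false h0)
    (by simpa only [bz_and] using bz_false h1)
    (by simpa only [bz_and] using bz_false h2)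
    (by simpa only [bz_and] using bz_false h3)
    (by simpa only [bz_and] using bz_false h4)
    (by simpa only [bz_and] using bz_false h5)
    (by simpa only [bz_and] using bz_false h6)
    (by simpa only [bz_and] using bz_false h7)
    (by simpa only [bz_and] using bz_false h8)
    (by simpa only [bz_and] using bz_false h9)
    (by simpa only [bz_and] using bz_false h10)
    (by simpa only [bz_and] using bz_false h11)
    (by simpa only [bz_and] using bz_false h12)
    (by simpa only [bz_and] using bz_false h13)
    (by simpa only [bz_and] using bz_false t0)
    (by simpa only [bz_and] using bz_false t1)
    (by simpa only [bz_and] using bz_false t2)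
    (by simpa only [bz_and] using bz_false t3)
    (by simpa only [bz_and] using bz_false t4)
    (by simpa only [bz_and] using bz_false t5)
    (by simpa only [bz_and] using bz_false t6)
    (by simpa only [bz_and] using bz_false t7)
    (by simpa only [bz_and] using bz_false t8)
    (by simpa only [bz_and] using bz_false t9)
  rw [← e]
  congr 1
  funext i j
  fin_cases i <;> fin_cases j <;> rfl

lemma permList_inj : ∀ p ∈ permList, Function.Injective p := by
  intro p hp
  simp only [permList, List.mem_cons, List.not_mem_nil, or_false] at hp
  rcases hp with rfl | rfl | rfl | rfl | rfl | rfl <;> decide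

lemma others_invol : ∀ g ∈ others, (∀ i, g (g i) = i) ∧ g 0 ≠ 1 ∨
    (∀ i, g (g i) = i) ∧ g 2 ≠ 3 := by
  intro g hg
  simp only [others, List.mem_cons, List.not_mem_nil, or_false] at hg
  rcases hg with rfl | rfl | rfl | rfl | rfl | rfl | rfl | rfl | rfl | rfl | rfl | rfl | rfl | rfl <;> decide

lemma det_tab0 : Matrix.det (n := Fin 6) (tabZ tab0) = 3 := by
  have : tabZ tab0 = !![0, 1, 1, 0, 0, 0; 1, 0, 1, 0, 0, 0; 1, 1, 0, 1, 0, 0; 0, 0, 1, 0, 1, 1; 0, 0, 0, 1, 0, 1; 0, 0, 0, 1, 1, 0] := by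
    funext i j
    fin_cases i <;> fin_cases j <;> rfl
  rw [this]
  simp [Matrix.det_succ_row_zero, Fin.sum_univ_succ, Fin.succAbove]

/-- The exceptional graph. -/
def exG : SimpleGraph (Fin 6) where
  Adj i j := tab0 i j = true
  symm := ⟨by decide⟩
  loopless := ⟨by decide⟩

/-- `f` is a perfect matching of `G`, as an involution. -/
def IsPMInv {V : Type*} (G : SimpleGraph V) (f : V → V) : Prop :=
  (∀ v, f (f v) = v) ∧ ∀ v, G.Adj v (f v)

/-- The subgraph of a matching involution. -/
def pmSub {V : Type*} (G : SimpleGraph V) (f : V → V) (hf : IsPMInv G f) : G.Subgraph where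
  verts := Set.univ
  Adj a b := f a = b
  adj_sub := by rintro a b rfl; exact hf.2 a
  edge_vert := fun _ => Set.mem_univ _
  symm := ⟨by rintro a b rfl; exact hf.1 a⟩

lemma pmSub_isPM {V : Type*} (G : SimpleGraph V) (f : V → V) (hf : IsPMInv G f) :
    (pmSub G f hf).IsPerfectMatching := by
  rw [SimpleGraph.Subgraph.isPerfectMatching_iff]
  intro v
  exact ⟨f v, rfl, fun y (hy : f v = y) => Eq.symm hy⟩

lemma exists_inv {V : Type*} (G : SimpleGraph V) (M : G.Subgraph) (hM : M.IsPerfectMatching) :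
    ∃ f : V → V, ∃ hf : IsPMInv G f, M = pmSub G f hf := by
  rw [SimpleGraph.Subgraph.isPerfectMatching_iff] at hM
  choose f hf hu using hM
  have h1 : ∀ v, f (f v) = v := fun v => (hu (f v) v (hf v).symm).symm
  refine ⟨f, ⟨h1, fun v => M.adj_sub (hf v)⟩, ?_⟩
  ext a b
  · simpa [pmSub] using M.edge_vert (hf a)
  · constructor
    · intro h
      exact (hu a b h).symm
    · rintro rfl
      exact hf a

lemma unique_iff {V : Type*} (G : SimpleGraph V) :
    HasUniquePM G ↔ ∃! f : V → V, IsPMInv G f := by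
  constructor
  · rintro ⟨M, hM, hu⟩
    obtain ⟨f, hf, rfl⟩ := exists_inv G M hM
    refine ⟨f, hf, fun g hg => ?_⟩
    have := hu _ (pmSub_isPM G g hg)
    funext v
    have h2 : (pmSub G g hg).Adj v (g v) := rfl
    rw [this] at h2
    exact Eq.symm h2
  · rintro ⟨f, hf, hu⟩
    refine ⟨pmSub G f hf, pmSub_isPM G f hf, fun M hM => ?_⟩
    obtain ⟨g, hg, rfl⟩ := exists_inv G M hM
    have := hu g hg
    subst this
    rfl

lemma adjMat_apply (G : SimpleGraph (Fin 6)) (b : Fin 6 → Fin 6 → Bool)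
    (hb : ∀ i j, b i j = true ↔ G.Adj i j) : adjMat G = tabZ b := by
  classical
  funext i j
  simp [adjMat, SimpleGraph.adjMatrix_apply, tabZ, hb]

lemma exG_det : (adjMat exG).det = 3 := by
  rw [adjMat_apply exG tab0 (fun _ _ => Iff.rfl), det_tab0]

lemma det_iso (G H : SimpleGraph (Fin 6)) (e : G ≃g H) : (adjMat G).det = (adjMat H).det := by
  have : adjMat G = (adjMat H).submatrix e.toEquiv e.toEquiv := by
    classical
    funext i j
    have h : H.Adj (e i) (e j) ↔ G.Adj i j := e.map_rel_iff
    simp [adjMat, SimpleGraph.adjMatrix_apply, h]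
  rw [this, Matrix.det_submatrix_equiv_self]

set_option synthInstance.maxHeartbeats 400000 in
set_option synthInstance.maxSize 4000 in
lemma exG_unique : HasUniquePM exG := by
  rw [unique_iff]
  refine ⟨![1, 0, 3, 2, 5, 4], ⟨by decide, by unfold exG; decide⟩, ?_⟩
  rintro g ⟨h1, h2⟩
  have key1 : ∀ a : Fin 6, tab0 0 a = true → ∀ b, tab0 1 b = true → ∀ c, tab0 2 c = true →
      (a = 2 → c = 0) → (b = 2 → c = 1) → (a = 1 → b = 0) → (b = 0 → a = 1) →
      (c = 0 → a = 2) → (c = 1 → b = 2) → a = 1 ∧ b = 0 ∧ c = 3 := by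
    decide
  have key2 : ∀ d : Fin 6, tab0 3 d = true → ∀ e, tab0 4 e = true → ∀ f, tab0 5 f = true →
      (e = 3 → d = 4) → (f = 3 → d = 5) → (e = 5 → f = 4) → (f = 4 → e = 5) →
      (d = 4 → e = 3) → (d = 5 → f = 3) → d = 2 ∧ e = 5 ∧ f = 4 := by
    decide
  have hr : ∀ i j, g i = j → g j = i := fun i j h => h ▸ h1 i
  obtain ⟨a, b, c⟩ := key1 _ (h2 0) _ (h2 1) _ (h2 2) (hr _ _) (hr _ _) (hr _ _) (hr _ _)
    (hr _ _) (hr _ _)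
  obtain ⟨d, e, f⟩ := key2 _ (h2 3) _ (h2 4) _ (h2 5) (hr _ _) (hr _ _) (hr _ _) (hr _ _)
    (hr _ _) (hr _ _)
  funext i
  fin_cases i <;> assumption

lemma exG_conn : exG.Connected := by
  have step : ∀ i j, tab0 i j = true → exG.Reachable i j := fun i j h =>
    SimpleGraph.Adj.reachable (G := exG) h
  have h2 : ∀ i, exG.Reachable 2 i := by
    have h23 := step 2 3 rfl
    intro i
    fin_cases i
    · exact step 2 0 rfl
    · exact step 2 1 rfl
    · exact SimpleGraph.Reachable.refl _
    · exact h23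
    · exact h23.trans (step 3 4 rfl)
    · exact h23.trans (step 3 5 rfl)
  exact { preconnected := fun i j => (h2 i).symm.trans (h2 j), nonempty := ⟨0⟩ }

lemma exists_std_perm (G : SimpleGraph (Fin 6)) (f : Fin 6 → Fin 6) (hf : IsPMInv G f) :
    ∃ s : Equiv.Perm (Fin 6), f (s 0) = s 1 ∧ f (s 2) = s 3 ∧ f (s 4) = s 5 := by
  have e1 : ∀ a b : Fin 6, ∃ c, c ≠ a ∧ c ≠ b := by decide
  have e2 : ∀ a b c d : Fin 6, ∃ e, e ≠ a ∧ e ≠ b ∧ e ≠ c ∧ e ≠ d := by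
    intro a b c d
    obtain ⟨e, -, he⟩ := Finset.exists_mem_notMem_of_card_lt_card
      (s := ({a, b, c, d} : Finset (Fin 6))) (t := Finset.univ)
      (lt_of_le_of_lt Finset.card_le_four (by simp))
    exact ⟨e, by simpa using he⟩
  have hfix : ∀ v, f v ≠ v := fun v h => (hf.2 v).ne h.symm
  have hii := hf.1
  obtain ⟨c, hc1, hc2⟩ := e1 0 (f 0)
  obtain ⟨e, h1, h2, h3, h4⟩ := e2 0 (f 0) c (f c)
  have hinj : Function.Injective ![0, f 0, c, f c, e, f e] := by
    have hc3 : f c ≠ 0 := fun h => hc2 (by rw [← h, hii])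
    have hc4 : f c ≠ f 0 := fun h => hc1 (by rw [← hii c, h, hii])
    have k1 : f e ≠ 0 := fun h => h2 (by rw [← h, hii])
    have k2 : f e ≠ f 0 := fun h => h1 (by rw [← hii e, h, hii])
    have k3 : f e ≠ c := fun h => h4 (by rw [← h, hii])
    have k4 : f e ≠ f c := fun h => h3 (by rw [← hii e, h, hii])
    have f0 := hfix 0
    have fc := hfix c
    have fe := hfix e
    intro i j h
    fin_cases i <;> fin_cases j <;> first | rfl | (exfalso; simp at h; first | exact absurd h (by assumption) | exact absurd h.symm (by assumption))
  exact ⟨Equiv.ofBijective _ (Finite.injective_iff_bijective.mp hinj), rfl, rfl, rfl⟩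

lemma main_dichotomy (G : SimpleGraph (Fin 6)) (hG : HasUniquePM G) :
    (adjMat G).det = -1 ∨ Nonempty (G ≃g exG) := by
  classical
  obtain ⟨f, hf, hu⟩ := (unique_iff G).mp hG
  obtain ⟨s, s0, s2, s4⟩ := exists_std_perm G f hf
  set H : SimpleGraph (Fin 6) := G.comap s with hH
  have eHG : H ≃g G := SimpleGraph.Iso.comap s G
  let b : Fin 6 → Fin 6 → Bool := fun i j => decide (H.Adj i j)
  have hb : ∀ i j, b i j = true ↔ H.Adj i j := fun i j => by simp [b]
  have hsym : ∀ i j, b i j = b j i := fun i j => by simp [b, H.adj_comm]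
  have hirr : ∀ i, b i i = false := fun i => by simp [b]
  have b01 : b 0 1 = true := (hb _ _).2 (by have := hf.2 (s 0); rwa [s0] at this)
  have b23 : b 2 3 = true := (hb _ _).2 (by have := hf.2 (s 2); rwa [s2] at this)
  have b45 : b 4 5 = true := (hb _ _).2 (by have := hf.2 (s 4); rwa [s4] at this)
  have htab : b = tab (b 0 2) (b 0 3) (b 0 4) (b 0 5) (b 1 2) (b 1 3) (b 1 4) (b 1 5) (b 2 4) (b 2 5) (b 3 4) (b 3 5) := by
    funext i j
    fin_cases i <;> fin_cases j <;>
      first | rfl | exact hirr _ | exact b01 | exact b23 | exact b45 | exact hsym _ _ |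
        exact (hsym _ _).trans b01 | exact (hsym _ _).trans b23 | exact (hsym _ _).trans b45
  have hdet : (adjMat G).det = Matrix.det (n := Fin 6) (tabZ b) := by
    rw [← det_iso H G eHG, adjMat_apply H b hb]
  have hgood := all_good (b 0 2) (b 0 3) (b 0 4) (b 0 5) (b 1 2) (b 1 3) (b 1 4) (b 1 5) (b 2 4) (b 2 5) (b 3 4) (b 3 5)
  rw [Bool.or_eq_true, Bool.or_eq_true] at hgood
  by_cases hbad : bad (b 0 2) (b 0 3) (b 0 4) (b 0 5) (b 1 2) (b 1 3) (b 1 4) (b 1 5) (b 2 4) (b 2 5) (b 3 4) (b 3 5) = true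
  · exfalso
    obtain ⟨g, hg, hm⟩ := bad_spec _ _ _ _ _ _ _ _ _ _ _ _ hbad
    rw [← htab] at hm
    have hinv : ∀ i, g (g i) = i := by
      rcases others_invol g hg with h | h <;> exact h.1
    have hadj : ∀ i, G.Adj (s i) (s (g i)) := by
      simp only [hasM, Bool.and_eq_true] at hm
      obtain ⟨⟨⟨⟨⟨m0, m1⟩, m2⟩, m3⟩, m4⟩, m5⟩ := hm
      intro i
      have : b i (g i) = true := by fin_cases i <;> assumption
      exact (hb _ _).1 this
    have := hu (fun v => s (g (s.symm v))) ⟨fun v => by simp [hinv], fun v => by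
      simpa using hadj (s.symm v)⟩
    have g0 : s (g 0) = s 1 := by rw [← s0, ← this]; simp
    have g2 : s (g 2) = s 3 := by rw [← s2, ← this]; simp
    rcases others_invol g hg with h | h
    · exact h.2 (s.injective g0)
    · exact h.2 (s.injective g2)
  rw [Bool.not_eq_true] at hbad
  rcases hgood with (h | h) | h
  · rw [hbad] at h
    exact absurd h Bool.false_ne_true
  · left
    rw [hdet, htab]
    exact det_tab _ _ _ _ _ _ _ _ _ _ _ _ hbad (by simpa using h)
  · right
    obtain ⟨p, hp, hm⟩ := isTwoTri_spec _ _ _ _ _ _ _ _ _ _ _ _ h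
    rw [← htab] at hm
    refine ⟨eHG.symm.trans ⟨Equiv.ofBijective p
      (Finite.injective_iff_bijective.mp (permList_inj p hp)), ?_⟩⟩
    intro i j
    rw [← hb, hm]
    rfl

/-- up to isomorphism, among connected simple graphs on 6 vertices
with a unique perfect matching, exactly one has adjacency determinant different
from ±1 (it equals ±3); all other classes have determinant ±1, hence are
integrally invertible. -/
theorem stmt9 : ∃ G₀ : SimpleGraph (Fin 6),
    G₀.Connected ∧ HasUniquePM G₀ ∧
    ((adjMat G₀).det = 3 ∨ (adjMat G₀).det = -3) ∧
    (∀ G : SimpleGraph (Fin 6), G.Connected → HasUniquePM G →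
      (((adjMat G).det ≠ 1 ∧ (adjMat G).det ≠ -1) ↔ Nonempty (G ≃g G₀))) ∧
    (∀ G : SimpleGraph (Fin 6), G.Connected → HasUniquePM G →
      ¬ Nonempty (G ≃g G₀) → IsUnit (adjMat G)) := by
  refine ⟨exG, exG_conn, exG_unique, Or.inl exG_det, ?_, ?_⟩
  · intro G _ hG
    constructor
    · rintro ⟨_, h⟩
      exact (main_dichotomy G hG).resolve_left h
    · rintro ⟨e⟩
      rw [det_iso G exG e, exG_det]
      decide
  · intro G _ hG hn
    rw [Matrix.isUnit_iff_isUnit_det, (main_dichotomy G hG).resolve_right hn]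
    exact isUnit_one.neg
end

section
/- Up to graph isomorphism, exactly 3 of the connected simple graphs on 6 vertices with a unique perfect matching are non-bipartite and negatively invertible. -/
open Matrix

/-- A graph is negatively invertible: its adjacency matrix is invertible over `ℤ`
and some diagonal ±1 matrix `D` makes all entries of `D A⁻¹ D` nonpositive. -/
def NegInvertible {V : Type*} [Fintype V] [DecidableEq V] (G : SimpleGraph V) : Prop :=
  IsUnit (adjMat G) ∧
  ∃ d : V → ℤ, (∀ i, d i = 1 ∨ d i = -1) ∧
    ∀ i j, (diagonal d * (adjMat G)⁻¹ * diagonal d) i j ≤ 0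

/-- A six-element type, on which kernel reduction is fast. -/
inductive V6 : Type
  | v0 | v1 | v2 | v3 | v4 | v5
  deriving DecidableEq

open V6

/-- The function on `V6` with the given values. -/
noncomputable def mk {α : Type} (a b c d e f : α) : V6 → α := fun v => V6.rec a b c d e f v

/-- The standard matching 01, 23, 45. -/
noncomputable def std : V6 → V6 := mk v1 v0 v3 v2 v5 v4

/-- Perfect matchings other than the standard one. -/
noncomputable def pmPool : List (V6 → V6) :=
  [mk v1 v0 v4 v5 v2 v3,
   mk v1 v0 v5 v4 v3 v2,
   mk v2 v3 v0 v1 v5 v4,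
   mk v2 v4 v0 v5 v1 v3,
   mk v2 v5 v0 v4 v3 v1,
   mk v3 v2 v1 v0 v5 v4,
   mk v3 v4 v5 v0 v1 v2,
   mk v3 v5 v4 v0 v2 v1,
   mk v4 v2 v1 v5 v0 v3,
   mk v4 v3 v5 v1 v0 v2,
   mk v4 v5 v3 v2 v0 v1,
   mk v5 v2 v1 v4 v3 v0,
   mk v5 v3 v4 v1 v2 v0,
   mk v5 v4 v3 v2 v1 v0]

/-- Swaps of endpoints of matching edges. -/
noncomputable def flips : List (V6 → V6) :=
  [mk v0 v1 v2 v3 v4 v5,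
   mk v1 v0 v2 v3 v4 v5,
   mk v0 v1 v3 v2 v4 v5,
   mk v1 v0 v3 v2 v4 v5,
   mk v0 v1 v2 v3 v5 v4,
   mk v1 v0 v2 v3 v5 v4,
   mk v0 v1 v3 v2 v5 v4,
   mk v1 v0 v3 v2 v5 v4]

/-- Permutations of the matching edges. -/
noncomputable def blocks : List (V6 → V6) :=
  [mk v0 v1 v2 v3 v4 v5,
   mk v0 v1 v4 v5 v2 v3,
   mk v2 v3 v0 v1 v4 v5,
   mk v2 v3 v4 v5 v0 v1,
   mk v4 v5 v0 v1 v2 v3,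
   mk v4 v5 v2 v3 v0 v1]

/-- The 48 symmetries of the standard matching. -/
noncomputable def permPool : List (V6 → V6) :=
  flips.flatMap fun f => blocks.map fun s => fun i => f (s i)

/-- Certificates `(c, y, z)` for `A (y - z) = c e_0`. -/
noncomputable def certPool : List (ℕ × (V6 → ℕ) × (V6 → ℕ)) :=
  [(1, mk 2 1 0 0 0 0, mk 0 0 1 1 1 0),
   (1, mk 2 1 0 0 0 0, mk 0 0 2 0 1 1),
   (1, mk 2 1 0 0 0 0, mk 0 0 1 1 0 0),
   (1, mk 2 1 0 0 0 1, mk 0 0 1 1 0 0),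
   (1, mk 2 1 0 0 0 0, mk 0 0 3 0 1 1),
   (1, mk 2 1 0 0 0 0, mk 0 0 1 0 1 0),
   (1, mk 2 1 0 0 0 2, mk 0 0 1 1 0 0),
   (1, mk 4 1 0 0 0 0, mk 0 0 1 1 1 1),
   (3, mk 0 0 1 1 2 2, mk 2 1 0 0 0 0)]

/-- Vertex sets that may be unions of components. -/
noncomputable def discPool : List (V6 → Bool) :=
  [mk true true false false false false,
   mk false false true true false false,
   mk false false false false true true]

/-- Candidate 2-colourings. -/
noncomputable def bipPool : List (V6 → Bool) :=
  [mk true false true false true false,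
   mk true false true false false true,
   mk true false false true true false,
   mk true false false true false true]

/-- Adjacency from the twelve non-matching bits. -/
noncomputable def ofBits (b02 b03 b04 b05 b12 b13 b14 b15 b24 b25 b34 b35 : Bool) : V6 → V6 → Bool :=
  mk (mk false true b02 b03 b04 b05)
    (mk true false b12 b13 b14 b15)
    (mk b02 b12 false true b24 b25)
    (mk b03 b13 true false b34 b35)
    (mk b04 b14 b24 b34 false true)
    (mk b05 b15 b25 b35 true false)

noncomputable def t1 : V6 → V6 → Bool :=
  ofBits true false true false false false false false true false false false

noncomputable def t2 : V6 → V6 → Bool :=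
  ofBits false true false true false false false false true false false false

noncomputable def t3 : V6 → V6 → Bool :=
  ofBits true true false true false false false false true false false false

noncomputable def all6 (f : V6 → Bool) : Bool := f v0 && (f v1 && (f v2 && (f v3 && (f v4 && f v5))))

theorem all6_spec {f : V6 → Bool} (h : all6 f = true) (i : V6) : f i = true := by
  simp only [all6, Bool.and_eq_true] at h
  obtain ⟨h0, h1, h2, h3, h4, h5⟩ := h
  cases i <;> assumption

def sel (b : Bool) (x : ℕ) : ℕ := cond b x 0

noncomputable def dot (r : V6 → Bool) (x : V6 → ℕ) : ℕ :=
  sel (r v0) (x v0) + sel (r v1) (x v1) + sel (r v2) (x v2) +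
    sel (r v3) (x v3) + sel (r v4) (x v4) + sel (r v5) (x v5)

noncomputable def certOK (a : V6 → V6 → Bool) (c : ℕ) (y z : V6 → ℕ) : Bool :=
  all6 fun j => Nat.beq (dot (a j) y) (dot (a j) z + mk c 0 0 0 0 0 j)

noncomputable def sameAs (a t : V6 → V6 → Bool) : Bool :=
  all6 fun i => all6 fun j => cond (a i j) (t i j) (!t i j)

noncomputable def base (a : V6 → V6 → Bool) : Bool :=
  sameAs a t1 || sameAs a t2 || sameAs a t3 || certPool.any fun q => certOK a q.1 q.2.1 q.2.2

/-- Evaluate a boolean before passing it on. -/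
noncomputable def force (b : Bool) (k : Bool → Bool) : Bool := Bool.rec (k false) (k true) b

theorem force_eq (b : Bool) (k : Bool → Bool) : force b k = k b := by cases b <;> rfl

/-- `base`, after normalising the adjacency bits. -/
noncomputable def baseOf (a : V6 → V6 → Bool) : Bool :=
  force (a v0 v2) fun b02 => force (a v0 v3) fun b03 => force (a v0 v4) fun b04 =>
  force (a v0 v5) fun b05 => force (a v1 v2) fun b12 => force (a v1 v3) fun b13 =>
  force (a v1 v4) fun b14 => force (a v1 v5) fun b15 => force (a v2 v4) fun b24 =>
  force (a v2 v5) fun b25 => force (a v3 v4) fun b34 => force (a v3 v5) fun b35 =>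
  base (ofBits b02 b03 b04 b05 b12 b13 b14 b15 b24 b25 b34 b35)

/-- Adjacency determined by the upper triangle of `a` away from the standard matching. -/
noncomputable def normal (a : V6 → V6 → Bool) : V6 → V6 → Bool :=
  ofBits (a v0 v2) (a v0 v3) (a v0 v4) (a v0 v5) (a v1 v2) (a v1 v3) (a v1 v4) (a v1 v5)
    (a v2 v4) (a v2 v5) (a v3 v4) (a v3 v5)

theorem baseOf_eq (a : V6 → V6 → Bool) : baseOf a = base (normal a) := by
  simp only [baseOf, force_eq, normal]

noncomputable def leaf (a : V6 → V6 → Bool) : Bool :=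
  (pmPool.any fun g => all6 fun i => a i (g i)) ||
  ((discPool.any fun s => all6 fun i => all6 fun j => !(a i j && (s i ^^ s j))) ||
  ((bipPool.any fun s => all6 fun i => all6 fun j => !(a i j && !(s i ^^ s j))) ||
  (permPool.any fun p => baseOf fun i j => a (p i) (p j))))

noncomputable def allB (f : Bool → Bool) : Bool := f true && f false

theorem allB_spec {f : Bool → Bool} (h : allB f = true) (b : Bool) : f b = true := by
  simp only [allB, Bool.and_eq_true] at h
  cases b
  · exact h.2
  · exact h.1

theorem allLeaves : (allB fun b02 => allB fun b03 => allB fun b04 => allB fun b05 =>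
    allB fun b12 => allB fun b13 => allB fun b14 => allB fun b15 =>
    allB fun b24 => allB fun b25 => allB fun b34 => allB fun b35 =>
    leaf (ofBits b02 b03 b04 b05 b12 b13 b14 b15 b24 b25 b34 b35)) = true := by
  decide +kernel

theorem leaf_all (b02 b03 b04 b05 b12 b13 b14 b15 b24 b25 b34 b35 : Bool) :
    leaf (ofBits b02 b03 b04 b05 b12 b13 b14 b15 b24 b25 b34 b35) = true :=
  allB_spec (allB_spec (allB_spec (allB_spec (allB_spec (allB_spec (allB_spec (allB_spec
    (allB_spec (allB_spec (allB_spec (allB_spec allLeaves b02) b03) b04) b05) b12) b13) b14)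
    b15) b24) b25) b34) b35
instance : Fintype V6 := ⟨{v0, v1, v2, v3, v4, v5}, by intro x; cases x <;> simp⟩

theorem sum_V6 (f : V6 → ℤ) : ∑ v, f v = f v0 + f v1 + f v2 + f v3 + f v4 + f v5 := by
  change ∑ v ∈ ({v0, v1, v2, v3, v4, v5} : Finset V6), f v = _
  rw [Finset.sum_insert (by decide), Finset.sum_insert (by decide), Finset.sum_insert (by decide),
    Finset.sum_insert (by decide), Finset.sum_insert (by decide), Finset.sum_singleton]
  ring

theorem flips_inj : ∀ p ∈ flips, ∀ i j, p i = p j → i = j := by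
  simp only [flips, List.forall_mem_cons]
  refine ⟨?_, ?_, ?_, ?_, ?_, ?_, ?_, ?_, by simp⟩ <;>
  · intro i j h
    cases i <;> cases j <;> first | rfl | (simp [mk] at h)

theorem blocks_inj : ∀ p ∈ blocks, ∀ i j, p i = p j → i = j := by
  simp only [blocks, List.forall_mem_cons]
  refine ⟨?_, ?_, ?_, ?_, ?_, ?_, by simp⟩ <;>
  · intro i j h
    cases i <;> cases j <;> first | rfl | (simp [mk] at h)

theorem flips_std : ∀ p ∈ flips, ∀ i, p (std i) = std (p i) := by
  simp only [flips, List.forall_mem_cons]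
  refine ⟨?_, ?_, ?_, ?_, ?_, ?_, ?_, ?_, by simp⟩ <;>
  · intro i
    cases i <;> rfl

theorem blocks_std : ∀ p ∈ blocks, ∀ i, p (std i) = std (p i) := by
  simp only [blocks, List.forall_mem_cons]
  refine ⟨?_, ?_, ?_, ?_, ?_, ?_, by simp⟩ <;>
  · intro i
    cases i <;> rfl

theorem permPool_spec (p : V6 → V6) (hp : p ∈ permPool) :
    Function.Injective p ∧ ∀ i, p (std i) = std (p i) := by
  simp only [permPool, List.mem_flatMap, List.mem_map] at hp
  obtain ⟨f, hf, s, hs, rfl⟩ := hp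
  refine ⟨fun i j h => blocks_inj s hs i j (flips_inj f hf _ _ h), fun i => ?_⟩
  simp only [blocks_std s hs, flips_std f hf]

theorem pmPool_spec : ∀ g ∈ pmPool, (∀ i, g (g i) = i) ∧ g ≠ std := by
  simp only [pmPool, List.forall_mem_cons]
  refine ⟨?_, ?_, ?_, ?_, ?_, ?_, ?_, ?_, ?_, ?_, ?_, ?_, ?_, ?_, by simp⟩ <;>
  · refine ⟨fun i => by cases i <;> rfl, fun h => ?_⟩
    have h0 := congrFun h v0
    have h2 := congrFun h v2
    simp [mk, std] at h0 h2

theorem certPool_spec : ∀ q ∈ certPool, 0 < q.1 ∧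
    ¬ ((q.2.1 v0 : ℤ) - q.2.2 v0 ≤ 0 ∧ (q.1 : ℤ) ∣ (q.2.1 v0 : ℤ) - q.2.2 v0) := by
  simp only [certPool, List.forall_mem_cons]
  refine ⟨?_, ?_, ?_, ?_, ?_, ?_, ?_, ?_, ?_, by simp⟩ <;> simp [mk]

theorem discPool_spec : ∀ s ∈ discPool, ∃ i j, s i ≠ s j := by
  simp only [discPool, List.forall_mem_cons]
  exact ⟨⟨v0, v2, by simp [mk]⟩, ⟨v0, v2, by simp [mk]⟩, ⟨v0, v4, by simp [mk]⟩, by simp⟩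

/-- Negative invertibility controls the diagonal of the inverse. -/
theorem negInv_diag {G : SimpleGraph (Fin 6)} (h : NegInvertible G) (x : Fin 6 → ℤ) (c : ℤ)
    (hc : 0 < c) (i : Fin 6) (hx : adjMat G *ᵥ x = c • Pi.single i 1) :
    x i ≤ 0 ∧ c ∣ x i := by
  obtain ⟨hu, d, hd, hn⟩ := h
  have hdet : IsUnit (adjMat G).det := (Matrix.isUnit_iff_isUnit_det _).1 hu
  have h1 : x = (adjMat G)⁻¹ *ᵥ (c • Pi.single i 1) := by
    rw [← hx, Matrix.mulVec_mulVec, Matrix.nonsing_inv_mul _ hdet, Matrix.one_mulVec]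
  have h2 : x i = c * (adjMat G)⁻¹ i i := by
    conv_lhs => rw [h1, Matrix.mulVec_smul, Matrix.mulVec_single_one]
    rfl
  have h3 := hn i i
  rw [Matrix.mul_diagonal, Matrix.diagonal_mul] at h3
  have h4 : (adjMat G)⁻¹ i i ≤ 0 := by
    rcases hd i with h | h <;> rw [h] at h3 <;> linarith
  exact ⟨by rw [h2]; nlinarith, h2 ▸ Dvd.intro _ rfl⟩

open Classical in
/-- Adjacency of `G` in the labelling `σ`. -/
noncomputable def lab (G : SimpleGraph (Fin 6)) (σ : V6 ≃ Fin 6) : V6 → V6 → Bool :=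
  fun i j => decide (G.Adj (σ i) (σ j))

theorem lab_iff (G : SimpleGraph (Fin 6)) (σ : V6 ≃ Fin 6) (i j : V6) :
    lab G σ i j = true ↔ G.Adj (σ i) (σ j) := by simp [lab]

theorem normal_lab (G : SimpleGraph (Fin 6)) (σ : V6 ≃ Fin 6)
    (h : ∀ i, G.Adj (σ i) (σ (std i))) : normal (lab G σ) = lab G σ := by
  have h01 : lab G σ v0 v1 = true := (lab_iff _ _ _ _).2 (h v0)
  have h23 : lab G σ v2 v3 = true := (lab_iff _ _ _ _).2 (h v2)
  have h45 : lab G σ v4 v5 = true := (lab_iff _ _ _ _).2 (h v4)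
  have hs : ∀ i j, lab G σ i j = lab G σ j i := by
    intro i j; simp [lab, G.adj_comm]
  have hl : ∀ i, lab G σ i i = false := by intro i; simp [lab]
  funext i j
  cases i <;> cases j <;> simp only [normal, ofBits, mk, hl] <;>
    first | rfl | exact h01.symm | exact h23.symm | exact h45.symm | exact hs _ _ |
      exact ((hs _ _).trans h01).symm | exact ((hs _ _).trans h23).symm |
      exact ((hs _ _).trans h45).symm

theorem sel_cast (G : SimpleGraph (Fin 6)) (σ : V6 ≃ Fin 6) (i j : V6) (n : ℕ) :
    ((sel (lab G σ i j) n : ℕ) : ℤ) = adjMat G (σ i) (σ j) * n := by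
  by_cases h : G.Adj (σ i) (σ j) <;> simp [sel, lab, adjMat, SimpleGraph.adjMatrix_apply, h]

theorem dot_cast (G : SimpleGraph (Fin 6)) (σ : V6 ≃ Fin 6) (i : V6) (x : V6 → ℕ) :
    ((dot (lab G σ i) x : ℕ) : ℤ) = ∑ j, adjMat G (σ i) (σ j) * x j := by
  rw [sum_V6]
  simp only [dot, Nat.cast_add, sel_cast]

theorem cert_sound {G : SimpleGraph (Fin 6)} (h : NegInvertible G) (σ : V6 ≃ Fin 6)
    (c : ℕ) (hc : 0 < c) (y z : V6 → ℕ) (hok : certOK (lab G σ) c y z = true) :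
    (y v0 : ℤ) - z v0 ≤ 0 ∧ (c : ℤ) ∣ (y v0 : ℤ) - z v0 := by
  have key := negInv_diag h (fun k => (y (σ.symm k) : ℤ) - z (σ.symm k)) c (by exact_mod_cast hc)
    (σ v0) ?_
  · simpa using key
  · funext k
    obtain ⟨j, rfl⟩ := σ.surjective k
    have h1 := Nat.eq_of_beq_eq_true (all6_spec hok j)
    have h2 : ((dot (lab G σ j) y : ℕ) : ℤ) = (dot (lab G σ j) z : ℕ) + (mk c 0 0 0 0 0 j : ℕ) := by
      exact_mod_cast h1
    rw [dot_cast, dot_cast] at h2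
    simp only [Matrix.mulVec, dotProduct]
    rw [← Equiv.sum_comp σ]
    simp only [Equiv.symm_apply_apply, mul_sub, Finset.sum_sub_distrib]
    rw [h2]
    cases j <;> simp [mk]

theorem pm_fun {G : SimpleGraph (Fin 6)} (M : G.Subgraph) (hM : M.IsPerfectMatching) :
    ∃ f : Fin 6 → Fin 6, (∀ v, f (f v) = v) ∧ (∀ v, G.Adj v (f v)) ∧
      ∀ v w, M.Adj v w ↔ w = f v := by
  rw [SimpleGraph.Subgraph.isPerfectMatching_iff] at hM
  choose f hf hu using hM
  refine ⟨f, fun v => (hu _ _ (hf v).symm).symm, fun v => M.adj_sub (hf v), fun v w => ?_⟩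
  exact ⟨fun h => hu _ _ h, fun h => h ▸ hf v⟩

/-- The subgraph of an involution. -/
def invSub (G : SimpleGraph (Fin 6)) (g : Fin 6 → Fin 6) (h1 : ∀ v, g (g v) = v)
    (h2 : ∀ v, G.Adj v (g v)) : G.Subgraph where
  verts := Set.univ
  Adj v w := w = g v
  adj_sub := by rintro v w rfl; exact h2 v
  edge_vert := fun _ => Set.mem_univ _
  symm := ⟨by rintro v w rfl; exact (h1 v).symm⟩

theorem invSub_pm (G : SimpleGraph (Fin 6)) (g : Fin 6 → Fin 6) (h1 : ∀ v, g (g v) = v)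
    (h2 : ∀ v, G.Adj v (g v)) : (invSub G g h1 h2).IsPerfectMatching := by
  rw [SimpleGraph.Subgraph.isPerfectMatching_iff]
  exact fun v => ⟨g v, rfl, fun w hw => hw⟩

theorem pm_unique {G : SimpleGraph (Fin 6)} (h : HasUniquePM G) :
    ∃ f : Fin 6 → Fin 6, (∀ v, f (f v) = v) ∧ (∀ v, G.Adj v (f v)) ∧
      ∀ g : Fin 6 → Fin 6, (∀ v, g (g v) = v) → (∀ v, G.Adj v (g v)) → g = f := by
  obtain ⟨M, hM, hu⟩ := h
  obtain ⟨f, hf1, hf2, hf3⟩ := pm_fun M hM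
  refine ⟨f, hf1, hf2, fun g h1 h2 => ?_⟩
  have h3 := hu _ (invSub_pm G g h1 h2)
  funext v
  rw [← hf3, ← h3]
  rfl

theorem exists_label (f : Fin 6 → Fin 6) (h1 : ∀ v, f (f v) = v) (h2 : ∀ v, f v ≠ v) :
    ∃ σ : V6 ≃ Fin 6, ∀ i, f (σ i) = σ (std i) := by
  obtain ⟨a, ha⟩ : ∃ a : Fin 6, a ∉ ({0, f 0} : Finset (Fin 6)) := by
    by_contra! hc
    have := Finset.card_le_card (fun x _ => hc x : (Finset.univ : Finset (Fin 6)) ⊆ _)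
    have h3 := Finset.card_le_two (a := (0 : Fin 6)) (b := f 0)
    simp only [Finset.card_univ, Fintype.card_fin] at this
    omega
  obtain ⟨b, hb⟩ : ∃ b : Fin 6, b ∉ ({0, f 0, a, f a} : Finset (Fin 6)) := by
    by_contra! hc
    have := Finset.card_le_card (fun x _ => hc x : (Finset.univ : Finset (Fin 6)) ⊆ _)
    have h3 := Finset.card_le_four (a := (0 : Fin 6)) (b := f 0) (c := a) (d := f a)
    simp only [Finset.card_univ, Fintype.card_fin] at this
    omega
  simp only [Finset.mem_insert, Finset.mem_singleton, not_or] at ha hb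
  obtain ⟨a0, a1⟩ := ha
  obtain ⟨b0, b1, b2, b3⟩ := hb
  have sw : ∀ x y, f x = y → x = f y := fun x y h => by rw [← h, h1]
  have inj : Function.Injective (mk 0 (f 0) a (f a) b (f b)) := by
    intro i j h
    cases i <;> cases j <;> simp only [mk] at h <;> first | rfl | (exfalso; grind)
  have bij : Function.Bijective (mk 0 (f 0) a (f a) b (f b)) :=
    (Fintype.bijective_iff_injective_and_card _).2 ⟨inj, rfl⟩
  refine ⟨Equiv.ofBijective _ bij, fun i => ?_⟩
  cases i <;> simp [mk, std, h1]

/-- The standard labelling. -/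
def toV : Fin 6 → V6
  | 0 => v0 | 1 => v1 | 2 => v2 | 3 => v3 | 4 => v4 | 5 => v5

theorem toV_bij : Function.Bijective toV := by
  refine (Fintype.bijective_iff_injective_and_card _).2 ⟨?_, rfl⟩
  decide

noncomputable def e6 : Fin 6 ≃ V6 := Equiv.ofBijective toV toV_bij

theorem sameAs_sound (a t : V6 → V6 → Bool) (h : sameAs a t = true) (i j : V6) : a i j = t i j := by
  have := all6_spec (all6_spec h i) j
  revert this
  cases a i j <;> cases t i j <;> simp

theorem classify (G : SimpleGraph (Fin 6)) (hc : G.Connected) (hu : HasUniquePM G)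
    (hb : ¬ G.Colorable 2) (hn : NegInvertible G) :
    ∃ σ : V6 ≃ Fin 6, lab G σ = t1 ∨ lab G σ = t2 ∨ lab G σ = t3 := by
  obtain ⟨f, hf1, hf2, hf3⟩ := pm_unique hu
  obtain ⟨σ, hσ⟩ := exists_label f hf1 (fun v h => (hf2 v).ne h.symm)
  have hstd : ∀ i, G.Adj (σ i) (σ (std i)) := fun i => hσ i ▸ hf2 (σ i)
  have hleaf : leaf (lab G σ) = true := by
    rw [← normal_lab G σ hstd]
    exact leaf_all _ _ _ _ _ _ _ _ _ _ _ _
  simp only [leaf, Bool.or_eq_true, List.any_eq_true] at hleaf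
  rcases hleaf with ⟨g, hg, h⟩ | ⟨s, hs, h⟩ | ⟨s, hs, h⟩ | ⟨p, hp, h⟩
  · exfalso
    obtain ⟨hg1, hg2⟩ := pmPool_spec g hg
    have h3 := hf3 (fun v => σ (g (σ.symm v))) (by intro v; simp [hg1]) (by
      intro v
      have := (lab_iff G σ _ _).1 (all6_spec h (σ.symm v))
      simpa using this)
    apply hg2
    funext i
    have := congrFun h3 (σ i)
    simp only [Equiv.symm_apply_apply, hσ] at this
    exact σ.injective this
  · exfalso
    obtain ⟨i, j, hij⟩ := discPool_spec s hs
    have hadj : ∀ v w, G.Adj v w → s (σ.symm v) = s (σ.symm w) := by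
      intro v w hvw
      have := all6_spec (all6_spec h (σ.symm v)) (σ.symm w)
      have h2 : lab G σ (σ.symm v) (σ.symm w) = true := by rw [lab_iff]; simpa using hvw
      rw [h2] at this
      simpa using this
    have hr : ∀ v w, G.Reachable v w → s (σ.symm v) = s (σ.symm w) := by
      rintro v w ⟨q⟩
      induction q with
      | nil => rfl
      | cons hd _ ih => exact (hadj _ _ hd).trans ih
    apply hij
    simpa using hr (σ i) (σ j) (hc.preconnected _ _)
  · exfalso
    apply hb
    have hadj : ∀ {v w}, G.Adj v w → s (σ.symm v) ≠ s (σ.symm w) := by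
      intro v w hvw
      have := all6_spec (all6_spec h (σ.symm v)) (σ.symm w)
      have h2 : lab G σ (σ.symm v) (σ.symm w) = true := by rw [lab_iff]; simpa using hvw
      rw [h2] at this
      simpa using this
    have := (SimpleGraph.Coloring.mk (G := G) (fun v => s (σ.symm v)) hadj).colorable
    simpa using this
  · obtain ⟨hp1, hp2⟩ := permPool_spec p hp
    have hpb : Function.Bijective p := Finite.injective_iff_bijective.1 hp1
    let τ : V6 ≃ Fin 6 := (Equiv.ofBijective p hpb).trans σ
    have hτ : (fun i j => lab G σ (p i) (p j)) = lab G τ := rfl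
    have hstd2 : ∀ i, G.Adj (τ i) (τ (std i)) := by
      intro i
      have := hstd (p i)
      rw [← hp2] at this
      exact this
    rw [hτ, baseOf_eq, normal_lab G τ hstd2] at h
    simp only [base, Bool.or_eq_true, List.any_eq_true] at h
    rcases h with ((h | h) | h) | ⟨q, hq, h⟩
    · exact ⟨τ, Or.inl (funext fun i => funext fun j => sameAs_sound _ _ h i j)⟩
    · exact ⟨τ, Or.inr (Or.inl (funext fun i => funext fun j => sameAs_sound _ _ h i j))⟩
    · exact ⟨τ, Or.inr (Or.inr (funext fun i => funext fun j => sameAs_sound _ _ h i j))⟩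
    · exact absurd (cert_sound hn τ _ (certPool_spec q hq).1 _ _ h) (certPool_spec q hq).2

/-- The three graphs, by explicit edges on `Fin 6`. -/
def g1 : SimpleGraph (Fin 6) where
  Adj i j := (![![0, 1, 1, 0, 1, 0], ![1, 0, 0, 0, 0, 0], ![1, 0, 0, 1, 1, 0],
    ![0, 0, 1, 0, 0, 0], ![1, 0, 1, 0, 0, 1], ![0, 0, 0, 0, 1, 0]] : Matrix _ _ ℤ) i j = 1
  symm := ⟨by decide⟩
  loopless := ⟨by decide⟩

def g2 : SimpleGraph (Fin 6) where
  Adj i j := (![![0, 1, 0, 1, 0, 1], ![1, 0, 0, 0, 0, 0], ![0, 0, 0, 1, 1, 0],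
    ![1, 0, 1, 0, 0, 0], ![0, 0, 1, 0, 0, 1], ![1, 0, 0, 0, 1, 0]] : Matrix _ _ ℤ) i j = 1
  symm := ⟨by decide⟩
  loopless := ⟨by decide⟩

def g3 : SimpleGraph (Fin 6) where
  Adj i j := (![![0, 1, 1, 1, 0, 1], ![1, 0, 0, 0, 0, 0], ![1, 0, 0, 1, 1, 0],
    ![1, 0, 1, 0, 0, 0], ![0, 0, 1, 0, 0, 1], ![1, 0, 0, 0, 1, 0]] : Matrix _ _ ℤ) i j = 1
  symm := ⟨by decide⟩
  loopless := ⟨by decide⟩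

instance : DecidableRel g1.Adj := fun _ _ => inferInstanceAs (Decidable (_ = (1 : ℤ)))
instance : DecidableRel g2.Adj := fun _ _ => inferInstanceAs (Decidable (_ = (1 : ℤ)))
instance : DecidableRel g3.Adj := fun _ _ => inferInstanceAs (Decidable (_ = (1 : ℤ)))

theorem iso_of_lab (G H : SimpleGraph (Fin 6)) (σ : V6 ≃ Fin 6) (t : V6 → V6 → Bool)
    (h : lab G σ = t) (hH : ∀ i j, H.Adj i j ↔ t (toV i) (toV j) = true) : Nonempty (G ≃g H) := by
  refine ⟨SimpleGraph.Iso.symm ⟨e6.trans σ, ?_⟩⟩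
  intro i j
  rw [hH, ← h, lab_iff]
  rfl

theorem g1_lab (i j : Fin 6) : g1.Adj i j ↔ t1 (toV i) (toV j) = true := by
  revert i j; decide +kernel

theorem g2_lab (i j : Fin 6) : g2.Adj i j ↔ t2 (toV i) (toV j) = true := by
  revert i j; decide +kernel

theorem g3_lab (i j : Fin 6) : g3.Adj i j ↔ t3 (toV i) (toV j) = true := by
  revert i j; decide +kernel

theorem conn_of (G : SimpleGraph (Fin 6)) (h : ∀ i : Fin 6, i ≠ 0 → ∃ j k, G.Adj i j ∧
    (j = 0 ∨ G.Adj j k ∧ (k = 0 ∨ G.Adj k 0))) : G.Connected := by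
  have h0 : ∀ i, G.Reachable i 0 := by
    intro i
    by_cases hi : i = 0
    · rw [hi]
    obtain ⟨j, k, h1, h2⟩ := h i hi
    refine h1.reachable.trans ?_
    rcases h2 with rfl | ⟨h2, h3⟩
    · rfl
    refine h2.reachable.trans ?_
    rcases h3 with rfl | h3
    · rfl
    exact h3.reachable
  haveI : Nonempty (Fin 6) := ⟨0⟩
  exact ⟨fun i j => (h0 i).trans (h0 j).symm⟩

theorem not_col (G : SimpleGraph (Fin 6)) (h : (∃ a b c, G.Adj a b ∧ G.Adj b c ∧ G.Adj c a) ∨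
    ∃ a b c d e, G.Adj a b ∧ G.Adj b c ∧ G.Adj c d ∧ G.Adj d e ∧ G.Adj e a) :
    ¬ G.Colorable 2 := by
  rintro ⟨c⟩
  have hv : ∀ v w, G.Adj v w → (c v).val ≠ (c w).val := fun v w h h2 => c.valid h (Fin.ext h2)
  rcases h with ⟨x, y, z, h1, h2, h3⟩ | ⟨x, y, z, u, v, h1, h2, h3, h4, h5⟩
  · have := hv _ _ h1; have := hv _ _ h2; have := hv _ _ h3
    omega
  · have := hv _ _ h1; have := hv _ _ h2; have := hv _ _ h3
    have := hv _ _ h4; have := hv _ _ h5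
    omega

theorem uniq_of (G : SimpleGraph (Fin 6)) (f0 : Fin 6 → Fin 6) (hf1 : ∀ v, f0 (f0 v) = v)
    (hf2 : ∀ v, G.Adj v (f0 v))
    (h1 : ∀ j, G.Adj 1 j → j = 0) (h3 : ∀ j, G.Adj 3 j → j = 0 ∨ j = 2)
    (h5 : ∀ j, G.Adj 5 j → j = 0 ∨ j = 4) (e : f0 = ![1, 0, 3, 2, 5, 4]) : HasUniquePM G := by
  refine ⟨invSub G f0 hf1 hf2, invSub_pm _ _ _ _, fun M hM => ?_⟩
  obtain ⟨f, k1, k2, k3⟩ := pm_fun M hM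
  have e1 : f 1 = 0 := h1 _ (k2 1)
  have e0 : f 0 = 1 := by rw [← e1, k1]
  have e3 : f 3 = 2 := by
    rcases h3 _ (k2 3) with h | h
    · have := k1 3
      rw [h, e0] at this
      exact absurd this (by decide)
    · exact h
  have e2 : f 2 = 3 := by rw [← e3, k1]
  have e5 : f 5 = 4 := by
    rcases h5 _ (k2 5) with h | h
    · have := k1 5
      rw [h, e0] at this
      exact absurd this (by decide)
    · exact h
  have e4 : f 4 = 5 := by rw [← e5, k1]
  have hff : f = f0 := by
    funext i
    rw [e]
    fin_cases i
    exacts [e0, e1, e2, e3, e4, e5]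
  subst hff
  have hS := (SimpleGraph.Subgraph.isPerfectMatching_iff.1 hM)
  ext v w
  · simp only [invSub, Set.mem_univ, iff_true]
    exact hM.2 v
  · exact k3 v w

theorem neg_of (G : SimpleGraph (Fin 6)) [DecidableRel G.Adj] (B : Matrix (Fin 6) (Fin 6) ℤ)
    (d : Fin 6 → ℤ) (hB : ∀ i j, ∑ k, (if G.Adj i k then B k j else 0) = if i = j then 1 else 0)
    (hd : ∀ i, d i = 1 ∨ d i = -1) (hn : ∀ i j, d i * B i j * d j ≤ 0) : NegInvertible G := by
  have h1 : adjMat G * B = 1 := by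
    ext i j
    rw [Matrix.mul_apply, Matrix.one_apply, ← hB i j]
    refine Finset.sum_congr rfl fun k _ => ?_
    by_cases h : G.Adj i k <;> simp [adjMat, SimpleGraph.adjMatrix_apply, h]
  refine ⟨?_, d, hd, fun i j => ?_⟩
  · rw [Matrix.isUnit_iff_isUnit_det]
    exact Matrix.isUnit_det_of_right_inverse h1
  · rw [Matrix.inv_eq_right_inv h1, Matrix.mul_diagonal, Matrix.diagonal_mul]
    exact hn i j

theorem g1_good : g1.Connected ∧ HasUniquePM g1 ∧ ¬ g1.Colorable 2 ∧ NegInvertible g1 :=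
  ⟨conn_of _ (by decide +kernel),
   uniq_of _ ![1, 0, 3, 2, 5, 4] (by decide) (by decide +kernel) (by decide +kernel)
    (by decide +kernel) (by decide +kernel) rfl,
   not_col _ (Or.inl ⟨0, 2, 4, by decide +kernel⟩),
   neg_of _ !![0, 1, 0, 0, 0, 0; 1, 0, 0, -1, 0, -1; 0, 0, 0, 1, 0, 0; 0, -1, 1, 0, 0, -1;
      0, 0, 0, 0, 0, 1; 0, -1, 0, -1, 1, 0] ![-1, 1, -1, 1, -1, 1]
    (by decide +kernel) (by decide +kernel) (by decide +kernel)⟩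

theorem g2_good : g2.Connected ∧ HasUniquePM g2 ∧ ¬ g2.Colorable 2 ∧ NegInvertible g2 :=
  ⟨conn_of _ (by decide +kernel),
   uniq_of _ ![1, 0, 3, 2, 5, 4] (by decide) (by decide +kernel) (by decide +kernel)
    (by decide +kernel) (by decide +kernel) rfl,
   not_col _ (Or.inr ⟨0, 3, 2, 4, 5, by decide +kernel⟩),
   neg_of _ !![0, 1, 0, 0, 0, 0; 1, -2, -1, 1, -1, 1; 0, -1, 0, 1, 0, 0; 0, 1, 1, 0, 0, -1;
      0, -1, 0, 0, 0, 1; 0, 1, 0, -1, 1, 0] ![1, -1, -1, 1, -1, 1]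
    (by decide +kernel) (by decide +kernel) (by decide +kernel)⟩

theorem g3_good : g3.Connected ∧ HasUniquePM g3 ∧ ¬ g3.Colorable 2 ∧ NegInvertible g3 :=
  ⟨conn_of _ (by decide +kernel),
   uniq_of _ ![1, 0, 3, 2, 5, 4] (by decide) (by decide +kernel) (by decide +kernel)
    (by decide +kernel) (by decide +kernel) rfl,
   not_col _ (Or.inl ⟨0, 2, 3, by decide +kernel⟩),
   neg_of _ !![0, 1, 0, 0, 0, 0; 1, 0, -1, 0, -1, 1; 0, -1, 0, 1, 0, 0; 0, 0, 1, 0, 0, -1;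
      0, -1, 0, 0, 0, 1; 0, 1, 0, -1, 1, 0] ![1, -1, -1, 1, -1, 1]
    (by decide +kernel) (by decide +kernel) (by decide +kernel)⟩

theorem not_iso_12 : ¬ Nonempty (g1 ≃g g2) := by
  rintro ⟨φ⟩
  have h : ∀ x y z, ¬ (g2.Adj x y ∧ g2.Adj y z ∧ g2.Adj z x) := by decide +kernel
  exact h (φ 0) (φ 2) (φ 4) ⟨φ.map_adj_iff.2 (by decide), φ.map_adj_iff.2 (by decide),
    φ.map_adj_iff.2 (by decide)⟩

theorem not_iso_23 : ¬ Nonempty (g2 ≃g g3) := by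
  rintro ⟨φ⟩
  have h : ∀ x y z, ¬ (g2.Adj x y ∧ g2.Adj y z ∧ g2.Adj z x) := by decide +kernel
  exact h (φ.symm 0) (φ.symm 2) (φ.symm 3) ⟨φ.symm.map_adj_iff.2 (by decide),
    φ.symm.map_adj_iff.2 (by decide), φ.symm.map_adj_iff.2 (by decide)⟩

theorem not_iso_13 : ¬ Nonempty (g1 ≃g g3) := by
  rintro ⟨φ⟩
  have h := φ.symm.degree_eq 0
  have h3 : g3.degree 0 = 4 := by decide +kernel
  have h1 : ∀ v, g1.degree v ≤ 3 := by decide +kernel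
  have := h1 (φ.symm 0)
  omega

/-- up to isomorphism, exactly 3 of the connected simple graphs on
6 vertices with a unique perfect matching are non-bipartite and negatively
invertible. -/
theorem stmt13 : ∃ L : List (SimpleGraph (Fin 6)),
    L.length = 3 ∧
    L.Pairwise (fun G H => ¬ Nonempty (G ≃g H)) ∧
    (∀ G ∈ L, G.Connected ∧ HasUniquePM G ∧ ¬ G.Colorable 2 ∧ NegInvertible G) ∧
    (∀ G : SimpleGraph (Fin 6), G.Connected → HasUniquePM G → ¬ G.Colorable 2 →
      NegInvertible G → ∃ H ∈ L, Nonempty (G ≃g H)) := by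

  refine ⟨[g1, g2, g3], rfl, ?_, ?_, ?_⟩
  · simp only [List.pairwise_cons, List.mem_cons, List.not_mem_nil, or_false, forall_eq_or_imp,
      forall_eq, IsEmpty.forall_iff, implies_true, List.Pairwise.nil, and_true]
    exact ⟨⟨not_iso_12, not_iso_13⟩, not_iso_23⟩
  · intro G hG
    simp only [List.mem_cons, List.not_mem_nil, or_false] at hG
    rcases hG with rfl | rfl | rfl
    · exact g1_good
    · exact g2_good
    · exact g3_good
  · intro G hc hu hb hn
    obtain ⟨σ, h | h | h⟩ := classify G hc hu hb hn
    · exact ⟨g1, by simp, iso_of_lab G g1 σ t1 h g1_lab⟩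
    · exact ⟨g2, by simp, iso_of_lab G g2 σ t2 h g2_lab⟩
    · exact ⟨g3, by simp, iso_of_lab G g3 σ t3 h g3_lab⟩
end
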